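/- Let H be a finite-index subgroup of ℤ², let G = ℤ²/H, and let ∂_1 : ℤG ⊕ ℤG → ℤG and ∂_2 : ℤG → ℤG ⊕ ℤG be the homomorphisms defined on generators by ∂_1(δ_g ⊕ 0) = δ_g − δ_{g+[e_1]}, ∂_1(0 ⊕ δ_g) = δ_g − δ_{g+[e_2]} and ∂_2(δ_g) = (δ_{g+[e_2]} − δ_g) ⊕ (δ_g − δ_{g+[e_1]}). Then ∂_1 ∘ ∂_2 = 0, the subgroup ker(∂_1) is free abelian of rank |G| + 1, and the quotient group ker(∂_1) / Im(∂_2) is isomorphic to H (in particular it is free abelian of rank 2). -/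

import Mathlib

/-- Every integer-valued sequence indexed by `ℤ` has a discrete antiderivative
with prescribed value at `0`. -/
theorem Int.exists_forward_difference_eq (b : ℤ → ℤ) (c : ℤ) :
    ∃ F : ℤ → ℤ, F 0 = c ∧ ∀ n, F (n + 1) - F n = b n := by
  refine ⟨fun n => c + (∑ k ∈ Finset.Ico 0 n, b k - ∑ k ∈ Finset.Ico n 0, b k), by simp, ?_⟩
  intro n
  rcases le_or_gt 0 n with hn | hn
  · beta_reduce
    rw [← Finset.insert_Ico_right_eq_Ico_add_one hn,
      Finset.Ico_eq_empty_of_le hn, Finset.Ico_eq_empty_of_le (show (0 : ℤ) ≤ n + 1 by omega)]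
    simp
  · beta_reduce
    rw [← Finset.insert_Ico_add_one_left_eq_Ico hn,
      Finset.Ico_eq_empty_of_le hn.le, Finset.Ico_eq_empty_of_le (show n + 1 ≤ (0 : ℤ) by omega)]
    simp

theorem Int.eq_of_forward_difference_eq {M : Type*} [AddCommGroup M] {u v : ℤ → M}
    (h0 : u 0 = v 0) (h : ∀ n, u (n + 1) - u n = v (n + 1) - v n) : u = v := by
  funext n
  induction n using Int.induction_on with
  | zero => exact h0
  | succ n ih =>
    have := h n
    rw [ih] at this
    exact sub_left_injective this
  | pred n ih =>
    have := h (-n - 1)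
    rw [sub_add_cancel, ih] at this
    exact sub_right_injective this

/-- The discrete Poincaré lemma on `ℤ²`: a closed discrete one-form is exact. -/
theorem Int.exists_potential (p q : ℤ → ℤ → ℤ)
    (hpq : ∀ m n, p m (n + 1) - p m n = q (m + 1) n - q m n) :
    ∃ F : ℤ → ℤ → ℤ, (∀ m n, F (m + 1) n - F m n = p m n) ∧
      ∀ m n, F m (n + 1) - F m n = q m n := by
  obtain ⟨u, -, hu⟩ := Int.exists_forward_difference_eq (q 0) 0
  choose F hF0 hF using fun n => Int.exists_forward_difference_eq (fun m => p m n) (u n)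
  refine ⟨fun m n => F n m, fun m n => hF n m, fun m n => ?_⟩
  refine congrFun (Int.eq_of_forward_difference_eq
    (u := fun m => F (n + 1) m - F n m) (v := fun m => q m n) ?_ fun m => ?_) m
  · simp [hF0, hu]
  · linear_combination hF (n + 1) m - hF n m + hpq m n

section Torus

variable {G : Type*} [AddCommGroup G] (x y : G)

/-- The boundary map from one-chains to zero-chains of the square complex on `G` with
generators `x` and `y`. -/
def torusBoundaryOne : (G → ℤ) × (G → ℤ) →+ (G → ℤ) where
  toFun c g := c.1 g - c.1 (g - x) + (c.2 g - c.2 (g - y))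
  map_zero' := by ext; simp
  map_add' c c' := by ext; simp; ring

/-- The boundary map from two-chains to one-chains of the square complex on `G` with
generators `x` and `y`. -/
def torusBoundaryTwo : (G → ℤ) →+ (G → ℤ) × (G → ℤ) where
  toFun f := (fun g => f (g - y) - f g, fun g => f g - f (g - x))
  map_zero' := by ext <;> simp
  map_add' f f' := by ext <;> simp <;> ring

/-- The total weight of a one-chain in each of the two directions. -/
def torusWinding {G : Type*} [Fintype G] : (G → ℤ) × (G → ℤ) →+ ℤ × ℤ where
  toFun c := (∑ g, c.1 g, ∑ g, c.2 g)
  map_zero' := by simp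
  map_add' c c' := by simp [Finset.sum_add_distrib]

theorem torusBoundaryOne_apply (c : (G → ℤ) × (G → ℤ)) (g : G) :
    torusBoundaryOne x y c g = c.1 g - c.1 (g - x) + (c.2 g - c.2 (g - y)) := rfl

theorem torusBoundaryTwo_apply (f : G → ℤ) :
    torusBoundaryTwo x y f = (fun g => f (g - y) - f g, fun g => f g - f (g - x)) := rfl

theorem torusWinding_apply {G : Type*} [Fintype G] (c : (G → ℤ) × (G → ℤ)) :
    torusWinding c = (∑ g, c.1 g, ∑ g, c.2 g) := rfl

theorem torusBoundaryOne_torusBoundaryTwo (f : G → ℤ) :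
    torusBoundaryOne x y (torusBoundaryTwo x y f) = 0 := by
  ext g
  simp only [torusBoundaryOne_apply, torusBoundaryTwo_apply, Pi.zero_apply,
    sub_right_comm g y x]
  ring

variable [Fintype G]

theorem torusWinding_torusBoundaryTwo (f : G → ℤ) :
    torusWinding (torusBoundaryTwo x y f) = 0 := by
  have h (z : G) : ∑ g, f (g - z) = ∑ g, f g := Equiv.sum_comp (Equiv.subRight z) f
  simp [torusWinding_apply, torusBoundaryTwo_apply, Finset.sum_sub_distrib, h]

theorem sum_torusBoundaryOne_smul (c : (G → ℤ) × (G → ℤ)) :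
    ∑ g, torusBoundaryOne x y c g • g = -((torusWinding c).1 • x + (torusWinding c).2 • y) := by
  have h (a : G → ℤ) (z : G) : ∑ g, a (g - z) • g = ∑ g, a g • g + (∑ g, a g) • z := by
    rw [← Equiv.sum_comp (Equiv.addRight z)]
    simp [smul_add, Finset.sum_add_distrib, Finset.sum_smul]
  simp only [torusBoundaryOne_apply, torusWinding_apply, add_smul, sub_smul,
    Finset.sum_add_distrib, Finset.sum_sub_distrib, h]
  abel

theorem exists_torusBoundaryOne_eq_single_sub_single [DecidableEq G] (m n : ℤ) (g : G) :
    ∃ c, torusBoundaryOne x y c = Pi.single g 1 - Pi.single (g + (m • x + n • y)) 1 ∧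
      torusWinding c = (m, n) := by
  let S : AddSubgroup (ℤ × ℤ) :=
    { carrier := {v | ∀ g, ∃ c, torusBoundaryOne x y c =
        Pi.single g 1 - Pi.single (g + (v.1 • x + v.2 • y)) 1 ∧ torusWinding c = v}
      zero_mem' := fun g => ⟨0, by simp⟩
      add_mem' := by
        intro v w hv hw g
        obtain ⟨c, hc, hc'⟩ := hv g
        obtain ⟨d, hd, hd'⟩ := hw (g + (v.1 • x + v.2 • y))
        refine ⟨c + d, ?_, by simp [hc', hd']⟩
        have : g + (v.1 • x + v.2 • y) + (w.1 • x + w.2 • y) =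
            g + ((v + w).1 • x + (v + w).2 • y) := by
          simp only [Prod.fst_add, Prod.snd_add, add_smul]; abel
        rw [map_add, hc, hd, this]
        abel
      neg_mem' := by
        intro v hv g
        obtain ⟨c, hc, hc'⟩ := hv (g + ((-v).1 • x + (-v).2 • y))
        refine ⟨-c, ?_, by simp [hc']⟩
        have : g + ((-v).1 • x + (-v).2 • y) + (v.1 • x + v.2 • y) = g := by
          simp only [Prod.fst_neg, Prod.snd_neg, neg_smul]; abel
        rw [map_neg, hc, this]
        abel }
  have h1 : ((1, 0) : ℤ × ℤ) ∈ S := fun g => by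
    refine ⟨(Pi.single g 1, 0), ?_, by simp [torusWinding_apply]⟩
    ext k
    simp [torusBoundaryOne_apply, Pi.single_apply, sub_eq_iff_eq_add]
  have h2 : ((0, 1) : ℤ × ℤ) ∈ S := fun g => by
    refine ⟨(0, Pi.single g 1), ?_, by simp [torusWinding_apply]⟩
    ext k
    simp [torusBoundaryOne_apply, Pi.single_apply, sub_eq_iff_eq_add]
  have h : ((m, n) : ℤ × ℤ) ∈ S := by
    simpa using add_mem (S.zsmul_mem h1 m) (S.zsmul_mem h2 n)
  exact h g

variable {x y} {F : ℤ → ℤ → ℤ} {p q : G → ℤ}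

omit [Fintype G] in
/-- A potential of a closed one-form on `G` changes by a constant along every period. -/
theorem potential_add_period_sub (hp : ∀ m n, F (m + 1) n - F m n = p (m • x + n • y))
    (hq : ∀ m n, F m (n + 1) - F m n = q (m • x + n • y)) {i j : ℤ}
    (hij : i • x + j • y = 0) (m n : ℤ) :
    F (m + i) (n + j) - F m n = F i j - F 0 0 := by
  have key (m n : ℤ) : (m + i) • x + (n + j) • y = m • x + n • y := by
    rw [add_smul, add_smul, add_add_add_comm, hij, add_zero]
  have h0 : (fun n => F i (n + j)) = fun n => F 0 n + (F i j - F 0 0) := by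
    refine Int.eq_of_forward_difference_eq (by simp) fun n => ?_
    have h1 := hq (0 + i) (n + j)
    rw [key] at h1
    rw [zero_add] at h1
    rw [add_right_comm]
    linear_combination h1 - hq 0 n
  have h1 : (fun m => F (m + i) (n + j)) = fun m => F m n + (F i j - F 0 0) := by
    refine Int.eq_of_forward_difference_eq (by simpa using congrFun h0 n) fun m => ?_
    have h1 := hp (m + i) (n + j)
    rw [key] at h1
    rw [add_right_comm]
    linear_combination h1 - hp m n
  linear_combination congrFun h1 m

/-- If the horizontal component of a closed one-form on `G` has total weight zero, then its
potential is periodic in the horizontal direction. -/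
theorem potential_periodic (hp : ∀ m n, F (m + 1) n - F m n = p (m • x + n • y))
    (hq : ∀ m n, F m (n + 1) - F m n = q (m • x + n • y))
    (hxy : ∀ g, ∃ m n : ℤ, m • x + n • y = g) (hsum : ∑ g, p g = 0) (n : ℤ) :
    Function.Periodic (fun m => F m n) (Fintype.card G : ℤ) := by
  set N := Fintype.card G with hN
  have hper (m n : ℤ) : F (m + N) n - F m n = F N 0 - F 0 0 := by
    simpa using potential_add_period_sub hp hq (i := N) (j := 0)
      (by simp [hN, card_nsmul_eq_zero]) m n
  have hT (g : G) : ∑ k ∈ Finset.range N, p (g + k • x) = F N 0 - F 0 0 := by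
    obtain ⟨m, n, rfl⟩ := hxy g
    rw [← hper m n]
    have := Finset.sum_range_sub (fun k : ℕ => F (m + k) n) N
    simp only [Nat.cast_zero, add_zero] at this
    rw [← this]
    refine Finset.sum_congr rfl fun k _ => ?_
    rw [Nat.cast_succ, ← add_assoc, hp, add_smul, natCast_zsmul, add_right_comm]
  have hc : (N : ℤ) * (F N 0 - F 0 0) = 0 := by
    have h1 : ∑ g : G, ∑ k ∈ Finset.range N, p (g + k • x) = N * (F N 0 - F 0 0) := by
      simp only [hT, Finset.sum_const, Finset.card_univ, nsmul_eq_mul, ← hN]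
    rw [← h1, Finset.sum_comm]
    refine Finset.sum_eq_zero fun k _ => ?_
    rw [← hsum]
    exact Equiv.sum_comp (Equiv.addRight (k • x)) p
  have hN0 : (N : ℤ) ≠ 0 := by simp [hN]
  intro m
  linear_combination hper m n + (mul_eq_zero.mp hc).resolve_left hN0

/-- A closed one-form on `G` of total weight zero has a potential on `G`. -/
theorem exists_eq_of_potential (hp : ∀ m n, F (m + 1) n - F m n = p (m • x + n • y))
    (hq : ∀ m n, F m (n + 1) - F m n = q (m • x + n • y))
    (hxy : ∀ g, ∃ m n : ℤ, m • x + n • y = g) (hp0 : ∑ g, p g = 0) (hq0 : ∑ g, q g = 0) :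
    ∃ f : G → ℤ, ∀ m n : ℤ, f (m • x + n • y) = F m n := by
  have hN0 : (Fintype.card G : ℤ) ≠ 0 := by simp
  have hyx (g : G) : ∃ m n : ℤ, m • y + n • x = g := by
    obtain ⟨m, n, h⟩ := hxy g
    exact ⟨n, m, by rw [add_comm, h]⟩
  have hF (i j : ℤ) (hij : i • x + j • y = 0) : F i j - F 0 0 = 0 := by
    have h1 : (fun k : ℤ => F (k * i) (k * j)) = fun k => F 0 0 + k * (F i j - F 0 0) := by
      refine Int.eq_of_forward_difference_eq (by simp) fun k => ?_
      have := potential_add_period_sub hp hq hij (k * i) (k * j)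
      simp only [add_mul, one_mul]
      linear_combination this
    have h2 := congrFun h1 (Fintype.card G)
    have h3 := (potential_periodic hp hq hxy hp0 (Fintype.card G * j)).int_mul i 0
    have h4 := (potential_periodic (F := fun m n => F n m) (x := y) (y := x)
      (fun m n => (hq n m).trans (by rw [add_comm])) (fun m n => (hp n m).trans (by rw [add_comm]))
      hyx hq0 0).int_mul j 0
    simp only [zero_add, mul_comm i, mul_comm j, Int.cast_id] at h3 h4
    refine (mul_eq_zero.mp ?_).resolve_left hN0
    linear_combination h3 + h4 - h2
  choose s t hst using hxy
  refine ⟨fun g => F (s g) (t g), fun m n => ?_⟩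
  set g := m • x + n • y with hg
  have hij : (s g - m) • x + (t g - n) • y = 0 := by
    rw [sub_smul, sub_smul, sub_add_sub_comm, hst, hg, sub_self]
  have := potential_add_period_sub hp hq hij m n
  rw [hF _ _ hij, add_sub_cancel, add_sub_cancel] at this
  exact sub_eq_zero.mp this

/-- The one-cycles without winding are the boundaries. -/
theorem exists_torusBoundaryTwo_eq (hxy : ∀ g, ∃ m n : ℤ, m • x + n • y = g)
    {c : (G → ℤ) × (G → ℤ)} (hc : torusBoundaryOne x y c = 0) (hw : torusWinding c = 0) :
    ∃ f, torusBoundaryTwo x y f = c := by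
  obtain ⟨a, b⟩ := c
  have ha : ∑ g, a g = 0 := congrArg Prod.fst hw
  have hb : ∑ g, b g = 0 := congrArg Prod.snd hw
  have hx (m n : ℤ) : (m + 1) • x + n • y = m • x + n • y + x := by
    rw [add_smul, one_smul, add_right_comm]
  have hy (m n : ℤ) : m • x + (n + 1) • y = m • x + n • y + y := by
    rw [add_smul, one_smul, add_assoc]
  obtain ⟨F, hp, hq⟩ := Int.exists_potential (fun m n => b (m • x + n • y + x))
    (fun m n => -a (m • x + n • y + y)) fun m n => by
      have := congrFun hc (m • x + n • y + x + y)
      simp only [torusBoundaryOne_apply, Pi.zero_apply, add_sub_cancel_right] at this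
      rw [add_right_comm _ x y, add_sub_cancel_right, add_right_comm _ y x] at this
      simp only [hx, hy]
      rw [add_right_comm _ y x]
      linear_combination this
  obtain ⟨f, hf⟩ := exists_eq_of_potential (p := fun g => b (g + x)) (q := fun g => -a (g + y))
    hp hq hxy ((Equiv.sum_comp (Equiv.addRight x) b).trans hb)
    (by rw [Finset.sum_neg_distrib, neg_eq_zero]
        exact (Equiv.sum_comp (Equiv.addRight y) a).trans ha)
  refine ⟨f, Prod.ext (funext fun g => ?_) (funext fun g => ?_)⟩
  · obtain ⟨m, n, h⟩ := hxy (g - y)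
    have := hq m n
    rw [← hf, ← hf, hy, h, sub_add_cancel] at this
    simp only [torusBoundaryTwo_apply]
    linear_combination -this
  · obtain ⟨m, n, h⟩ := hxy (g - x)
    have := hp m n
    rw [← hf, ← hf, hx, h, sub_add_cancel] at this
    exact this

omit [Fintype G] in
/-- The only two-cycles are the constant functions. -/
theorem torusBoundaryTwo_eq_zero_iff (hxy : ∀ g, ∃ m n : ℤ, m • x + n • y = g)
    (f : G → ℤ) : torusBoundaryTwo x y f = 0 ↔ ∃ k, Function.const G k = f := by
  constructor
  · intro h
    have h1 (g : G) : f (g + y) = f g := by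
      have := congrFun (congrArg Prod.fst h) (g + y)
      simp only [torusBoundaryTwo_apply, add_sub_cancel_right, Prod.fst_zero, Pi.zero_apply]
        at this
      linear_combination -this
    have h2 (g : G) : f (g + x) = f g := by
      have := congrFun (congrArg Prod.snd h) (g + x)
      simp only [torusBoundaryTwo_apply, add_sub_cancel_right, Prod.snd_zero, Pi.zero_apply]
        at this
      linear_combination this
    refine ⟨f 0, funext fun g => ?_⟩
    obtain ⟨m, n, rfl⟩ := hxy g
    have h3 := (show Function.Periodic f x from h2).zsmul m
    have h4 := (show Function.Periodic f y from h1).zsmul n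
    rw [h4, ← zero_add (m • x), h3, Function.const_apply]
  · rintro ⟨k, rfl⟩
    ext <;> simp [torusBoundaryTwo_apply]

end Torus

/-- The rank of the middle term of a sequence `A → K → B` that is exact at `K` and `B`. -/
theorem AddMonoidHom.finrank_add_finrank_ker_of_exact {A K B : Type*} [AddCommGroup A]
    [AddCommGroup K] [AddCommGroup B] [Module.Finite ℤ A] [Module.Finite ℤ K]
    (f : A →+ K) (φ : K →+ B) (hφ : Function.Surjective φ) (h : φ.ker = f.range) :
    Module.finrank ℤ K + Module.finrank ℤ f.ker = Module.finrank ℤ A + Module.finrank ℤ B := by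
  have h1 := f.toIntLinearMap.ker.finrank_quotient_add_finrank
  have h2 := φ.toIntLinearMap.ker.finrank_quotient_add_finrank
  rw [LinearEquiv.finrank_eq (LinearMap.quotKerEquivRange _)] at h1 h2
  have h3 : φ.toIntLinearMap.ker = f.toIntLinearMap.range := by
    ext k
    exact SetLike.ext_iff.mp h k
  rw [LinearMap.range_eq_top.mpr hφ, finrank_top, h3] at h2
  have h4 : Module.finrank ℤ f.ker = Module.finrank ℤ f.toIntLinearMap.ker := rfl
  omega

/-- Finitely generated free abelian groups of the same rank are isomorphic. -/
theorem nonempty_addEquiv_of_finrank_eq {A B : Type*} [AddCommGroup A] [AddCommGroup B]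
    [Module.Finite ℤ A] [Module.Finite ℤ B] [Module.Free ℤ A] [Module.Free ℤ B]
    (h : Module.finrank ℤ A = Module.finrank ℤ B) : Nonempty (A ≃+ B) :=
  ⟨(LinearEquiv.ofFinrankEq A B h).toAddEquiv⟩


/-- for a finite-index subgroup `H ≤ ℤ²` with `G = ℤ²/H` and the boundary
maps `∂₁ : ℤG ⊕ ℤG → ℤG`, `∂₂ : ℤG → ℤG ⊕ ℤG` of the chain complex computing
`K_*(C^*(Δ₂/H))`: `∂₁ ∘ ∂₂ = 0`, `ker(∂₁)` is free abelian of rank `|G| + 1`, and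
`ker(∂₁)/Im(∂₂)` is isomorphic to `H` (in particular free abelian of rank 2). -/
theorem ker_d1_mod_im_d2 (H : AddSubgroup (ℤ × ℤ))
    [Fintype ((ℤ × ℤ) ⧸ H)] [DecidableEq ((ℤ × ℤ) ⧸ H)]
    (d1 : ((((ℤ × ℤ) ⧸ H) → ℤ) × (((ℤ × ℤ) ⧸ H) → ℤ)) →+ (((ℤ × ℤ) ⧸ H) → ℤ))
    (hd1a : ∀ g : (ℤ × ℤ) ⧸ H,
      d1 (Pi.single g (1 : ℤ), 0) =
        Pi.single g (1 : ℤ) - Pi.single (g + QuotientAddGroup.mk ((1, 0) : ℤ × ℤ)) (1 : ℤ))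
    (hd1b : ∀ g : (ℤ × ℤ) ⧸ H,
      d1 (0, Pi.single g (1 : ℤ)) =
        Pi.single g (1 : ℤ) - Pi.single (g + QuotientAddGroup.mk ((0, 1) : ℤ × ℤ)) (1 : ℤ))
    (d2 : (((ℤ × ℤ) ⧸ H) → ℤ) →+ ((((ℤ × ℤ) ⧸ H) → ℤ) × (((ℤ × ℤ) ⧸ H) → ℤ)))
    (hd2 : ∀ g : (ℤ × ℤ) ⧸ H,
      d2 (Pi.single g (1 : ℤ)) =
        (Pi.single (g + QuotientAddGroup.mk ((0, 1) : ℤ × ℤ)) (1 : ℤ) - Pi.single g (1 : ℤ),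
         Pi.single g (1 : ℤ) - Pi.single (g + QuotientAddGroup.mk ((1, 0) : ℤ × ℤ)) (1 : ℤ))) :
    (∀ f : ((ℤ × ℤ) ⧸ H) → ℤ, d1 (d2 f) = 0) ∧
    Nonempty (d1.ker ≃+ (Fin (Fintype.card ((ℤ × ℤ) ⧸ H) + 1) → ℤ)) ∧
    Nonempty ((d1.ker ⧸ d2.range.addSubgroupOf d1.ker) ≃+ H) ∧
    Nonempty ((d1.ker ⧸ d2.range.addSubgroupOf d1.ker) ≃+ (ℤ × ℤ)) := by
  set x : (ℤ × ℤ) ⧸ H := QuotientAddGroup.mk ((1, 0) : ℤ × ℤ) with hx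
  set y : (ℤ × ℤ) ⧸ H := QuotientAddGroup.mk ((0, 1) : ℤ × ℤ) with hy
  have hmk (v : ℤ × ℤ) : v.1 • x + v.2 • y = QuotientAddGroup.mk v := by
    rw [hx, hy, ← QuotientAddGroup.mk_zsmul, ← QuotientAddGroup.mk_zsmul, ← QuotientAddGroup.mk_add]
    simp
  have hxy (g : (ℤ × ℤ) ⧸ H) : ∃ m n : ℤ, m • x + n • y = g := by
    obtain ⟨v, rfl⟩ := QuotientAddGroup.mk_surjective g
    exact ⟨v.1, v.2, hmk v⟩
  obtain rfl : d1 = torusBoundaryOne x y := by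
    rw [← d1.coprod_unique, ← (torusBoundaryOne x y).coprod_unique]
    congr 1
    · ext g k
      simp [hd1a, torusBoundaryOne_apply, Pi.single_apply, sub_eq_iff_eq_add]
    · ext g k
      simp [hd1b, torusBoundaryOne_apply, Pi.single_apply, sub_eq_iff_eq_add]
  obtain rfl : d2 = torusBoundaryTwo x y := by
    ext g k
    · simp [hd2, torusBoundaryTwo_apply, Pi.single_apply, sub_eq_iff_eq_add]
    · simp [hd2, torusBoundaryTwo_apply, Pi.single_apply, sub_eq_iff_eq_add]
  set K := (torusBoundaryOne x y).ker
  let f : (((ℤ × ℤ) ⧸ H) → ℤ) →+ K :=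
    (torusBoundaryTwo x y).codRestrict K (torusBoundaryOne_torusBoundaryTwo x y)
  let φ : K →+ H := (torusWinding.comp K.subtype).codRestrict H fun c => by
    have := sum_torusBoundaryOne_smul x y c.1
    rw [show torusBoundaryOne x y c.1 = 0 from c.2, hmk] at this
    rw [← QuotientAddGroup.eq_zero_iff]
    simpa using this
  have hφ : Function.Surjective φ := by
    rintro ⟨v, hv⟩
    obtain ⟨c, hc, hc'⟩ := exists_torusBoundaryOne_eq_single_sub_single x y v.1 v.2 0
    rw [hmk, (QuotientAddGroup.eq_zero_iff v).mpr hv, add_zero, sub_self] at hc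
    exact ⟨⟨c, hc⟩, Subtype.ext hc'⟩
  have hf : φ.ker = f.range := by
    ext c
    constructor
    · intro h
      obtain ⟨a, ha⟩ := exists_torusBoundaryTwo_eq hxy c.2 (congrArg Subtype.val h)
      exact ⟨a, Subtype.ext ha⟩
    · rintro ⟨a, rfl⟩
      exact Subtype.ext (torusWinding_torusBoundaryTwo x y a)
  have hf' : (torusBoundaryTwo x y).range.addSubgroupOf K = φ.ker := by
    rw [hf]
    ext c
    exact exists_congr fun a => (Subtype.ext_iff (a1 := f a) (a2 := c)).symm
  have e : (K ⧸ (torusBoundaryTwo x y).range.addSubgroupOf K) ≃+ H :=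
    (QuotientAddGroup.quotientAddEquivOfEq hf').trans
      (QuotientAddGroup.quotientKerEquivOfSurjective φ hφ)
  have hfin : H.FiniteIndex := AddSubgroup.finiteIndex_of_finite_quotient
  have hHfinite : Module.Finite ℤ H := inferInstanceAs (Module.Finite ℤ H.toIntSubmodule)
  have hHfree : Module.Free ℤ H := inferInstanceAs (Module.Free ℤ H.toIntSubmodule)
  have hKfinite : Module.Finite ℤ K := inferInstanceAs (Module.Finite ℤ K.toIntSubmodule)
  have hKfree : Module.Free ℤ K := inferInstanceAs (Module.Free ℤ K.toIntSubmodule)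
  have hH : Module.finrank ℤ H = 2 := by
    rw [AddSubgroup.finrank_eq_of_finiteIndex]
    simp
  have hker : Module.finrank ℤ f.ker = 1 := by
    have hle : f.toIntLinearMap.ker =
        (LinearMap.pi fun _ : (ℤ × ℤ) ⧸ H => (LinearMap.id : ℤ →ₗ[ℤ] ℤ)).range := by
      ext a
      exact Subtype.ext_iff.trans (torusBoundaryTwo_eq_zero_iff hxy a)
    have h1 : Module.finrank ℤ f.ker = Module.finrank ℤ f.toIntLinearMap.ker := rfl
    rw [h1, hle, LinearMap.finrank_range_of_inj fun a b h => congrFun h 0, Module.finrank_self]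
  have hrank := f.finrank_add_finrank_ker_of_exact φ hφ hf
  rw [hker, hH, Module.finrank_fintype_fun_eq_card] at hrank
  refine ⟨torusBoundaryOne_torusBoundaryTwo x y, nonempty_addEquiv_of_finrank_eq ?_, ⟨e⟩, ?_⟩
  · rw [Module.finrank_fin_fun]
    omega
  · obtain ⟨e'⟩ := nonempty_addEquiv_of_finrank_eq (A := H) (B := ℤ × ℤ) (by simp [hH])
    exact ⟨e.trans e'⟩
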